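/- arXiv:1811.12575 — 3 statements merged into one kernel-verified Lean document; each statement's English description precedes it below -/
import Mathlib

section
/- Let p : ℕ → ℝ be a nonincreasing probability sequence with p 0 ≤ 2/3, and let π : ℕ × ℕ → ℕ be any bijection. Then the total variation distance between the rearranged distribution (j,k) ↦ p (π (j,k)) and the product distribution (j,k) ↦ p j · p k is at least 2/9; that is, (1/2) · ∑'_{(j,k)} |p (π (j,k)) − p j · p k| ≥ 2/9. -/
/-- A finite sum of an antitone sequence is at most the sum of its first terms. -/
theorem Antitone.sum_le_sum_range_card {p : ℕ → ℝ} (hp : Antitone p) (s : Finset ℕ) :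
    ∑ i ∈ s, p i ≤ ∑ i ∈ Finset.range s.card, p i := by
  induction s using Finset.induction_on_max with
  | empty => simp
  | insert a s hs ih =>
    have ha : a ∉ s := fun h => lt_irrefl a (hs a h)
    have hcard : s.card ≤ a := by
      simpa using Finset.card_le_card (fun x hx => Finset.mem_range.2 (hs x hx) :
        s ⊆ Finset.range a)
    rw [Finset.sum_insert ha, Finset.card_insert_of_notMem ha, Finset.sum_range_succ]
    linarith [hp hcard]

/-- A set of `n` pairs has product weight at most the weight of the initial `n × n` square. -/
theorem Antitone.sum_mul_le_sq_sum_range_card {p : ℕ → ℝ} (hp : Antitone p)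
    (hnonneg : ∀ k, 0 ≤ p k) (A : Finset (ℕ × ℕ)) :
    ∑ x ∈ A, p x.1 * p x.2 ≤ (∑ i ∈ Finset.range A.card, p i) ^ 2 := by
  have key : ∀ f : ℕ × ℕ → ℕ,
      ∑ i ∈ A.image f, p i ≤ ∑ i ∈ Finset.range A.card, p i := fun f =>
    (hp.sum_le_sum_range_card _).trans <|
      Finset.sum_le_sum_of_subset_of_nonneg
        (Finset.range_subset_range.2 Finset.card_image_le) fun i _ _ => hnonneg i
  calc ∑ x ∈ A, p x.1 * p x.2
      ≤ ∑ x ∈ A.image Prod.fst ×ˢ A.image Prod.snd, p x.1 * p x.2 :=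
        Finset.sum_le_sum_of_subset_of_nonneg Finset.subset_product
          fun x _ _ => mul_nonneg (hnonneg _) (hnonneg _)
    _ = (∑ i ∈ A.image Prod.fst, p i) * ∑ i ∈ A.image Prod.snd, p i := by
        rw [Finset.sum_mul_sum, Finset.sum_product]
    _ ≤ (∑ i ∈ Finset.range A.card, p i) ^ 2 := by
        rw [sq]
        exact mul_le_mul (key _) (key _) (Finset.sum_nonneg fun i _ => hnonneg i)
          (Finset.sum_nonneg fun i _ => hnonneg i)

/-- The total variation distance bounds the difference of the weights of a finite set. -/
theorem sum_sub_sum_le_half_tsum_abs_sub {ι : Type*} {q r : ι → ℝ} {a : ℝ}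
    (hq : HasSum q a) (hr : HasSum r a) (A : Finset ι) :
    ∑ i ∈ A, q i - ∑ i ∈ A, r i ≤ (1 / 2) * ∑' i, |q i - r i| := by
  have hf : HasSum (fun i => q i - r i) 0 := by simpa using hq.sub hr
  have hF := hf.summable.abs.hasSum.add hf
  have h1 := sum_le_hasSum A
    (fun i _ => by linarith [neg_abs_le (q i - r i)]) hF
  have h2 : ∑ i ∈ A, 2 * (q i - r i) ≤ ∑ i ∈ A, (|q i - r i| + (q i - r i)) :=
    Finset.sum_le_sum fun i _ => by linarith [le_abs_self (q i - r i)]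
  rw [← Finset.mul_sum, Finset.sum_sub_distrib] at h2
  linarith

/-- Some partial sum of the sequence lies in the middle third. -/
theorem exists_sum_range_mem_Icc {p : ℕ → ℝ} (hp : Antitone p) (hsum : HasSum p 1)
    (h0 : p 0 ≤ 2 / 3) :
    ∃ n, ∑ i ∈ Finset.range n, p i ∈ Set.Icc (1 / 3 : ℝ) (2 / 3) := by
  classical
  have hex : ∃ n, 1 / 3 ≤ ∑ i ∈ Finset.range n, p i :=
    (hsum.tendsto_sum_nat.eventually (eventually_ge_nhds (by norm_num))).exists
  refine ⟨Nat.find hex, Nat.find_spec hex, ?_⟩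
  rcases hn : Nat.find hex with _ | m
  · norm_num
  · have hm : ∑ i ∈ Finset.range m, p i < 1 / 3 :=
      not_le.1 (Nat.find_min hex (by omega))
    rw [Finset.sum_range_succ]
    rcases m with _ | m
    · simpa using h0
    · have hp0 : p 0 < 1 / 3 := by
        have := Nat.find_min hex (m := 1) (by omega)
        simpa using this
      linarith [hp (Nat.zero_le (m + 1))]

/-- For a nonincreasing probability sequence `p` with `p 0 ≤ 2/3` and any
bijection `π : ℕ × ℕ → ℕ`, the total variation distance between the rearranged
distribution `(j,k) ↦ p (π (j,k))` and the product distribution `(j,k) ↦ p j * p k`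
is at least `2/9`. -/
theorem self_embezzlement_tv_lower_bound
    (p : ℕ → ℝ)
    (hnonneg : ∀ k, 0 ≤ p (k + 1))
    (hmono : ∀ k, p (k + 1) ≤ p k)
    (hsum : Summable p)
    (htot : ∑' k, p k = 1)
    (h0 : p 0 ≤ 2 / 3)
    (π : ℕ × ℕ → ℕ) (hπ : Function.Bijective π) :
    (1 / 2) * ∑' jk : ℕ × ℕ, |p (π jk) - p jk.1 * p jk.2| ≥ 2 / 9 := by
  have hp : Antitone p := antitone_nat_of_succ_le hmono
  have hnn : ∀ k, 0 ≤ p k := fun k => (hnonneg k).trans (hmono k)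
  have hs : HasSum p 1 := htot ▸ hsum.hasSum
  obtain ⟨n, hn1, hn2⟩ := exists_sum_range_mem_Icc hp hs h0
  let e := Equiv.ofBijective π hπ
  have hq : HasSum (fun x => p (π x)) 1 := e.hasSum_iff.2 hs
  have hr : HasSum (fun x : ℕ × ℕ => p x.1 * p x.2) 1 := by
    simpa using hs.mul hs (hsum.mul_of_nonneg hsum hnn hnn)
  let A := (Finset.range n).map e.symm.toEmbedding
  have hA : ∑ x ∈ A, p (π x) = ∑ i ∈ Finset.range n, p i := by
    rw [Finset.sum_map]
    exact Finset.sum_congr rfl fun i _ => congrArg p (e.apply_symm_apply i)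
  have hTV := sum_sub_sum_le_half_tsum_abs_sub hq hr A
  have hprod := hp.sum_mul_le_sq_sum_range_card hnn A
  rw [Finset.card_map, Finset.card_range] at hprod
  rw [hA] at hTV
  nlinarith [mul_nonneg (sub_nonneg.2 hn1) (sub_nonneg.2 hn2)]
end

section
/- Let p : ℕ → ℝ be a nonincreasing probability sequence, let π : ℕ × ℕ → ℕ be any bijection, and let m ≥ 1. Set μ = ∑_{k=0}^{m−1} p k. Then the total variation distance between the rearranged distribution (j,k) ↦ p (π (j,k)) and the product distribution (j,k) ↦ p j · p k is at least μ(1 − μ); that is, (1/2) · ∑'_{(j,k)} |p (π (j,k)) − p j · p k| ≥ μ · (1 − μ). -/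
/-- The first `m` terms of a nonnegative antitone sequence dominate any `m` terms. -/
theorem Antitone.sum_le_sum_range_of_card_le {p : ℕ → ℝ} (hp : Antitone p) (h0 : ∀ k, 0 ≤ p k)
    {m : ℕ} {s : Finset ℕ} (hs : s.card ≤ m) :
    ∑ k ∈ s, p k ≤ ∑ k ∈ Finset.range m, p k := by
  have hcard : (s \ Finset.range m).card ≤ (Finset.range m \ s).card := by
    have h₁ := Finset.card_sdiff_add_card_inter s (Finset.range m)
    have h₂ := Finset.card_sdiff_add_card_inter (Finset.range m) s
    rw [Finset.inter_comm, Finset.card_range] at h₂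
    omega
  have hupper : ∑ k ∈ s \ Finset.range m, p k ≤ (s \ Finset.range m).card • p m :=
    Finset.sum_le_card_nsmul _ _ _ fun k hk => hp (by simpa using (Finset.mem_sdiff.1 hk).2)
  have hlower : (Finset.range m \ s).card • p m ≤ ∑ k ∈ Finset.range m \ s, p k :=
    Finset.card_nsmul_le_sum _ _ _ fun k hk =>
      hp (Finset.mem_range.1 (Finset.mem_sdiff.1 hk).1).le
  have hmid := nsmul_le_nsmul_left (h0 m) hcard
  rw [← Finset.sum_inter_add_sum_sdiff s (Finset.range m),
    ← Finset.sum_inter_add_sum_sdiff (Finset.range m) s, Finset.inter_comm]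
  linarith

/-- The product weight of a set of at most `m` pairs is at most the square of the weight of the
first `m` terms. -/
theorem Antitone.sum_mul_le_sq_sum_range_of_card_le {p : ℕ → ℝ} (hp : Antitone p)
    (h0 : ∀ k, 0 ≤ p k) {m : ℕ} {s : Finset (ℕ × ℕ)} (hs : s.card ≤ m) :
    ∑ x ∈ s, p x.1 * p x.2 ≤ (∑ k ∈ Finset.range m, p k) ^ 2 := by
  calc ∑ x ∈ s, p x.1 * p x.2
      ≤ ∑ x ∈ s.image Prod.fst ×ˢ s.image Prod.snd, p x.1 * p x.2 :=
        Finset.sum_le_sum_of_subset_of_nonneg Finset.subset_product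
          fun x _ _ => mul_nonneg (h0 _) (h0 _)
    _ = (∑ j ∈ s.image Prod.fst, p j) * ∑ k ∈ s.image Prod.snd, p k := by
        rw [Finset.sum_mul_sum, Finset.sum_product]
    _ ≤ (∑ k ∈ Finset.range m, p k) * ∑ k ∈ Finset.range m, p k :=
        mul_le_mul (hp.sum_le_sum_range_of_card_le h0 (Finset.card_image_le.trans hs))
          (hp.sum_le_sum_range_of_card_le h0 (Finset.card_image_le.trans hs))
          (Finset.sum_nonneg fun _ _ => h0 _) (Finset.sum_nonneg fun _ _ => h0 _)
    _ = (∑ k ∈ Finset.range m, p k) ^ 2 := (sq _).symm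

/-- If `f` sums to zero, then every finite partial sum is at most half the `ℓ¹` norm of `f`. -/
theorem HasSum.sum_le_half_tsum_abs {ι : Type*} {f : ι → ℝ} (hf : HasSum f 0) (s : Finset ι) :
    ∑ i ∈ s, f i ≤ (1 / 2) * ∑' i, |f i| := by
  have hsum : HasSum (fun i => |f i| + f i) (∑' i, |f i|) := by
    simpa using hf.summable.abs.hasSum.add hf
  have hle := sum_le_hasSum s (fun i _ => by linarith [neg_abs_le (f i)]) hsum
  have htwo : ∑ i ∈ s, 2 * f i ≤ ∑ i ∈ s, (|f i| + f i) :=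
    Finset.sum_le_sum fun i _ => by linarith [le_abs_self (f i)]
  rw [← Finset.mul_sum] at htwo
  linarith

/-- For a nonincreasing probability sequence `p`, any bijection
`π : ℕ × ℕ → ℕ`, and any `m ≥ 1`, writing `μ = ∑_{k<m} p k`, the total variation
distance between the rearranged distribution and the product distribution is at
least `μ * (1 - μ)`. -/
theorem self_embezzlement_tv_lower_bound_mu
    (p : ℕ → ℝ)
    (hnonneg : ∀ k, 0 ≤ p (k + 1))
    (hmono : ∀ k, p (k + 1) ≤ p k)
    (hsum : Summable p)
    (htot : ∑' k, p k = 1)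
    (π : ℕ × ℕ → ℕ) (hπ : Function.Bijective π)
    (m : ℕ) (hm : 1 ≤ m) :
    (1 / 2) * ∑' jk : ℕ × ℕ, |p (π jk) - p jk.1 * p jk.2| ≥
      (∑ k ∈ Finset.range m, p k) * (1 - ∑ k ∈ Finset.range m, p k) := by
  have h0 : ∀ k, 0 ≤ p k
    | 0 => (hnonneg 0).trans (hmono 0)
    | k + 1 => hnonneg k
  have hp : Antitone p := antitone_nat_of_succ_le hmono
  have hasSum : HasSum p 1 := htot ▸ hsum.hasSum
  let e := Equiv.ofBijective π hπ
  have hrearranged : HasSum (fun x => p (π x)) 1 := e.hasSum_iff.2 hasSum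
  have hproduct : HasSum (fun x : ℕ × ℕ => p x.1 * p x.2) 1 := by
    simpa using hasSum.mul hasSum (hsum.mul_of_nonneg hsum h0 h0)
  have hdiff : HasSum (fun x => p (π x) - p x.1 * p x.2) 0 := by
    simpa using hrearranged.sub hproduct
  let s := (Finset.range m).map e.symm.toEmbedding
  have htv := hdiff.sum_le_half_tsum_abs s
  have hs : ∑ x ∈ s, p (π x) = ∑ k ∈ Finset.range m, p k := by
    rw [Finset.sum_map]
    exact Finset.sum_congr rfl fun k _ => congrArg p (e.apply_symm_apply k)
  have hsq := hp.sum_mul_le_sq_sum_range_of_card_le h0 (m := m) (s := s) (by simp [s])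
  rw [Finset.sum_sub_distrib, hs] at htv
  linarith
end

section
/- Let p : ℕ → ℝ be a nonincreasing probability sequence with p 0 ≤ 2/3. Then there exists m ≥ 1 such that 1/3 < ∑_{k=0}^{m−1} p k ≤ 2/3. -/
/-- For a nonincreasing probability sequence `p` with `p 0 ≤ 2/3`,
there exists `m ≥ 1` such that `1/3 < ∑_{k<m} p k ≤ 2/3`. -/
theorem exists_partial_sum_between_third_and_two_thirds
    (p : ℕ → ℝ)
    (hnonneg : ∀ k, 0 ≤ p (k + 1))
    (hmono : ∀ k, p (k + 1) ≤ p k)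
    (hsum : Summable p)
    (htot : ∑' k, p k = 1)
    (h0 : p 0 ≤ 2 / 3) :
    ∃ m : ℕ, 1 ≤ m ∧ 1 / 3 < ∑ k ∈ Finset.range m, p k ∧
      ∑ k ∈ Finset.range m, p k ≤ 2 / 3 := by
  have hex : ∃ n, 1 / 3 < ∑ k ∈ Finset.range n, p k :=
    (hsum.hasSum.tendsto_sum_nat.eventually_const_lt (by rw [htot]; norm_num)).exists
  classical
  have hlt := Nat.find_spec hex
  have hmin : ∀ m, m < Nat.find hex → ∑ k ∈ Finset.range m, p k ≤ 1 / 3 :=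
    fun m hm => not_lt.mp (Nat.find_min hex hm)
  generalize Nat.find hex = n at hlt hmin
  match n with
  | 0 => norm_num at hlt
  | 1 => exact ⟨1, le_rfl, hlt, by simpa using h0⟩
  | n + 2 =>
    refine ⟨n + 2, by omega, hlt, ?_⟩
    have hprev := hmin (n + 1) (by omega)
    have hanti : p (n + 1) ≤ p 0 := antitone_nat_of_succ_le hmono (Nat.zero_le _)
    have htail : 0 ≤ ∑ k ∈ Finset.range n, p (k + 1) :=
      Finset.sum_nonneg fun k _ => hnonneg k
    have hsplit := Finset.sum_range_succ' p n
    rw [Finset.sum_range_succ]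
    linarith
end
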